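/- arXiv:1901.04078 — 3 statements merged into one kernel-verified Lean document; each statement's English description precedes it below -/
import Mathlib

section
/- For all real constants G > 0, A > 0, ε > 0 and N_0 > 0, the improper integral ∫_{−∞}^{∞} G²·(4π²f² + ε²)·N_0 / ( 2·( (4π²f² − G·A·ε)² + 4π²f²·G²·A² ) ) df converges and equals N_0·(G·A + ε) / (4·A²). -/
open Real MeasureTheory

section helpers
open Set Filter Topology

lemma aux_Q_pos (k : ℝ) (hk : 0 < k) (y : ℝ) : 0 < (y ^ 2 - 1) ^ 2 + k ^ 2 * y ^ 2 := by
  by_cases h : y = 0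
  · subst h; norm_num
  · positivity

lemma aux_integrable (k : ℝ) (hk : 0 < k) (a b : ℝ) :
    Integrable (fun y : ℝ => (a * y ^ 2 + b) / ((y ^ 2 - 1) ^ 2 + k ^ 2 * y ^ 2)) := by
  have h0 := (integrable_inv_one_add_sq).const_mul ((|a| + |b|) * (1 + 4 / k ^ 2))
  refine h0.mono' ?_ (Eventually.of_forall fun y => ?_)
  · apply Continuous.aestronglyMeasurable
    exact Continuous.div (by fun_prop) (by fun_prop) (fun y => (aux_Q_pos k hk y).ne')
  · have hQ := aux_Q_pos k hk y
    have h1 : |a * y ^ 2 + b| ≤ (|a| + |b|) * (1 + y ^ 2) := by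
      have := abs_add_le (a * y ^ 2) b
      rw [abs_mul, abs_of_nonneg (sq_nonneg y)] at this
      nlinarith [abs_nonneg a, abs_nonneg b, mul_nonneg (abs_nonneg b) (sq_nonneg y)]
    have h2 : (1 + y ^ 2) ^ 2 ≤ (1 + 4 / k ^ 2) * ((y ^ 2 - 1) ^ 2 + k ^ 2 * y ^ 2) := by
      have : (1 + 4 / k ^ 2) * ((y ^ 2 - 1) ^ 2 + k ^ 2 * y ^ 2) - (1 + y ^ 2) ^ 2
          = 4 / k ^ 2 * (y ^ 2 - 1) ^ 2 + k ^ 2 * y ^ 2 := by field_simp; ring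
      have : 0 ≤ 4 / k ^ 2 * (y ^ 2 - 1) ^ 2 + k ^ 2 * y ^ 2 := by positivity
      linarith
    rw [norm_div, Real.norm_eq_abs, Real.norm_eq_abs, abs_of_pos hQ, ← div_eq_mul_inv,
      div_le_div_iff₀ hQ (by positivity)]
    calc |a * y ^ 2 + b| * (1 + y ^ 2) ≤ (|a| + |b|) * (1 + y ^ 2) * (1 + y ^ 2) := by gcongr
      _ = (|a| + |b|) * (1 + y ^ 2) ^ 2 := by ring
      _ ≤ (|a| + |b|) * ((1 + 4 / k ^ 2) * ((y ^ 2 - 1) ^ 2 + k ^ 2 * y ^ 2)) := by gcongr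
      _ = _ := by ring

lemma aux_sum (k : ℝ) (hk : 0 < k) :
    ∫ y in Ioi (0 : ℝ), (1 * y ^ 2 + 1) / ((y ^ 2 - 1) ^ 2 + k ^ 2 * y ^ 2) = π / k := by
  set g : ℝ → ℝ := fun y => arctan ((y - y⁻¹) / k) / k with hg
  have htop : Tendsto g atTop (𝓝 (π / 2 / k)) := by
    refine Tendsto.div_const ?_ k
    refine (tendsto_arctan_atTop.mono_right nhdsWithin_le_nhds).comp ?_
    refine Tendsto.atTop_div_const hk ?_
    simpa [sub_eq_add_neg] using tendsto_id.atTop_add (tendsto_inv_atTop_zero (𝕜 := ℝ)).neg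
  have hzero : Tendsto g (𝓝[>] 0) (𝓝 (-(π / 2) / k)) := by
    refine Tendsto.div_const ?_ k
    refine (tendsto_arctan_atBot.mono_right nhdsWithin_le_nhds).comp ?_
    refine Tendsto.atBot_div_const hk ?_
    have h1 : Tendsto (fun y : ℝ => y) (𝓝[>] 0) (𝓝 0) := nhdsWithin_le_nhds
    simpa [sub_eq_add_neg] using
      h1.add_atBot (tendsto_neg_atTop_atBot.comp (tendsto_inv_nhdsGT_zero (𝕜 := ℝ)))
  have key := integral_Ioi_of_hasDerivAt_of_tendsto (a := 0) (m := π / 2 / k)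
    (f := Function.update g 0 (-(π / 2) / k))
    (f' := fun y => (1 * y ^ 2 + 1) / ((y ^ 2 - 1) ^ 2 + k ^ 2 * y ^ 2)) ?_ ?_
    (aux_integrable k hk 1 1).integrableOn ?_
  · rw [key, Function.update_self]; field_simp; ring
  · rw [continuousWithinAt_update_same, Ici_sdiff_left]
    exact hzero
  · intro y hy
    have hy' : y ≠ 0 := (ne_of_gt hy)
    have hd : HasDerivAt g ((1 * y ^ 2 + 1) / ((y ^ 2 - 1) ^ 2 + k ^ 2 * y ^ 2)) y := by
      have hd0 : HasDerivAt g (1 / (1 + ((id y - y⁻¹) / k) ^ 2) * ((1 - -(y ^ 2)⁻¹) / k) / k) y :=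
        ((((hasDerivAt_id y).sub (hasDerivAt_inv hy')).div_const k).arctan).div_const k
      refine hd0.congr_deriv ?_
      have hQ := aux_Q_pos k hk y
      have e : 1 + ((id y - y⁻¹) / k) ^ 2 = ((y ^ 2 - 1) ^ 2 + k ^ 2 * y ^ 2) / (k ^ 2 * y ^ 2) := by
        simp only [id]; field_simp; ring
      rw [e]
      field_simp
      try ring
    refine hd.congr_of_eventuallyEq ?_
    filter_upwards [isOpen_ne.mem_nhds hy'] with z hz
    exact Function.update_of_ne hz _ _
  · refine htop.congr' ?_
    filter_upwards [eventually_gt_atTop 0] with z hz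
    exact (Function.update_of_ne (ne_of_gt hz) _ _).symm

lemma aux_inv (k : ℝ) (hk : 0 < k) :
    ∫ y in Ioi (0 : ℝ), (1 * y ^ 2 + 0) / ((y ^ 2 - 1) ^ 2 + k ^ 2 * y ^ 2) =
    ∫ y in Ioi (0 : ℝ), (0 * y ^ 2 + 1) / ((y ^ 2 - 1) ^ 2 + k ^ 2 * y ^ 2) := by
  rw [← integral_comp_rpow_Ioi (fun y : ℝ => (0 * y ^ 2 + 1) / ((y ^ 2 - 1) ^ 2 + k ^ 2 * y ^ 2))
    (p := -1) (by norm_num)]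
  refine setIntegral_congr_fun measurableSet_Ioi fun y hy => ?_
  have hy : 0 < y := hy
  have hQ := aux_Q_pos k hk y
  have e1 : y ^ (-1 - 1 : ℝ) = (y ^ 2)⁻¹ := by
    rw [show (-1 - 1 : ℝ) = -((2 : ℕ) : ℝ) by norm_num, rpow_neg hy.le, rpow_natCast]
  have e : (y⁻¹ ^ 2 - 1) ^ 2 + k ^ 2 * y⁻¹ ^ 2 = ((y ^ 2 - 1) ^ 2 + k ^ 2 * y ^ 2) / y ^ 4 := by
    field_simp; ring
  simp only [e1, rpow_neg_one, smul_eq_mul, e]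
  norm_num
  field_simp

lemma aux_half (k : ℝ) (hk : 0 < k) (a b : ℝ) :
    ∫ y in Ioi (0 : ℝ), (a * y ^ 2 + b) / ((y ^ 2 - 1) ^ 2 + k ^ 2 * y ^ 2) =
      (a + b) * (π / (2 * k)) := by
  have i1 := (aux_integrable k hk 1 0).integrableOn (s := Ioi (0 : ℝ))
  have i2 := (aux_integrable k hk 0 1).integrableOn (s := Ioi (0 : ℝ))
  have lin : ∀ a b : ℝ, ∫ y in Ioi (0 : ℝ), (a * y ^ 2 + b) / ((y ^ 2 - 1) ^ 2 + k ^ 2 * y ^ 2) =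
      a * (∫ y in Ioi (0 : ℝ), (1 * y ^ 2 + 0) / ((y ^ 2 - 1) ^ 2 + k ^ 2 * y ^ 2)) +
      b * (∫ y in Ioi (0 : ℝ), (0 * y ^ 2 + 1) / ((y ^ 2 - 1) ^ 2 + k ^ 2 * y ^ 2)) := by
    intro a b
    rw [← integral_const_mul, ← integral_const_mul,
      ← integral_add (i1.const_mul a) (i2.const_mul b)]
    congr 1; ext y; ring
  have h1 := aux_sum k hk
  rw [lin, aux_inv k hk] at h1
  rw [lin, aux_inv k hk]
  have h2 : (∫ y in Ioi (0 : ℝ), (0 * y ^ 2 + 1) / ((y ^ 2 - 1) ^ 2 + k ^ 2 * y ^ 2))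
      = π / (2 * k) := by
    have : π / (2 * k) = (π / k) / 2 := by field_simp
    linarith
  rw [h2]; ring

lemma aux_full (k : ℝ) (hk : 0 < k) (a b : ℝ) :
    ∫ y : ℝ, (a * y ^ 2 + b) / ((y ^ 2 - 1) ^ 2 + k ^ 2 * y ^ 2) = (a + b) * (π / k) := by
  have := integral_comp_abs
    (f := fun y : ℝ => (a * y ^ 2 + b) / ((y ^ 2 - 1) ^ 2 + k ^ 2 * y ^ 2))
  simp only [sq_abs] at this
  rw [this, aux_half k hk]
  field_simp

end helpers

/-- The integral over all frequencies of the locked-state phase-noise power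
spectral density of the linearized single PLL converges and equals the phase-noise
variance `N₀ (G A + ε) / (4 A²)` (equations (16) and (18) of the paper, with
`S_w(f) = N₀`). -/
theorem stmt10 (G A ε N0 : ℝ) (hG : 0 < G) (hA : 0 < A) (hε : 0 < ε) (hN0 : 0 < N0) :
    Integrable (fun f : ℝ =>
      G ^ 2 * (4 * π ^ 2 * f ^ 2 + ε ^ 2) * N0 /
        (2 * ((4 * π ^ 2 * f ^ 2 - G * A * ε) ^ 2 + 4 * π ^ 2 * f ^ 2 * G ^ 2 * A ^ 2))) ∧
    (∫ f : ℝ,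
      G ^ 2 * (4 * π ^ 2 * f ^ 2 + ε ^ 2) * N0 /
        (2 * ((4 * π ^ 2 * f ^ 2 - G * A * ε) ^ 2 + 4 * π ^ 2 * f ^ 2 * G ^ 2 * A ^ 2)))
      = N0 * (G * A + ε) / (4 * A ^ 2) := by
  obtain ⟨s, hs, hsb⟩ : ∃ s : ℝ, 0 < s ∧ s ^ 2 = G * A * ε :=
    ⟨√(G * A * ε), by positivity, Real.sq_sqrt (by positivity)⟩
  have hk : 0 < G * A / s := by positivity
  have hπ := Real.pi_pos
  have hR : 2 * π / s ≠ 0 := by positivity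
  set a := G ^ 2 * N0 * s ^ 2 / (2 * s ^ 4) with ha
  set b := G ^ 2 * N0 * ε ^ 2 / (2 * s ^ 4) with hb
  set g : ℝ → ℝ := fun y => (a * y ^ 2 + b) / ((y ^ 2 - 1) ^ 2 + (G * A / s) ^ 2 * y ^ 2) with hg
  have hfun : (fun f : ℝ =>
      G ^ 2 * (4 * π ^ 2 * f ^ 2 + ε ^ 2) * N0 /
        (2 * ((4 * π ^ 2 * f ^ 2 - G * A * ε) ^ 2 + 4 * π ^ 2 * f ^ 2 * G ^ 2 * A ^ 2)))
      = fun f => g (2 * π / s * f) := by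
    ext f
    have e1 : ((2 * π / s * f) ^ 2 - 1) ^ 2 + (G * A / s) ^ 2 * (2 * π / s * f) ^ 2
        = ((4 * π ^ 2 * f ^ 2 - G * A * ε) ^ 2 + 4 * π ^ 2 * f ^ 2 * G ^ 2 * A ^ 2) / s ^ 4 := by
      rw [← hsb]; field_simp; ring
    have e2 : a * (2 * π / s * f) ^ 2 + b
        = (G ^ 2 * (4 * π ^ 2 * f ^ 2 + ε ^ 2) * N0 / 2) / s ^ 4 := by
      rw [ha, hb]; field_simp; ring
    simp only [hg]
    rw [e1, e2, div_div_div_cancel_right₀ (by positivity), div_div]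
  rw [hfun]
  refine ⟨(integrable_comp_mul_left_iff g hR).2 (aux_integrable _ hk a b), ?_⟩
  rw [Measure.integral_comp_mul_left g, aux_full _ hk a b, abs_of_pos (by positivity), smul_eq_mul,
    ha, hb]
  have e4 : s ^ 4 = (G * A * ε) ^ 2 := by rw [← hsb]; ring
  have : (2 * π / s)⁻¹ * ((G ^ 2 * N0 * s ^ 2 / (2 * s ^ 4) + G ^ 2 * N0 * ε ^ 2 / (2 * s ^ 4)) *
      (π / (G * A / s))) = G * N0 * (s ^ 2 + ε ^ 2) * s ^ 2 / (4 * A * s ^ 4) := by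
    field_simp; ring
  rw [this, e4, hsb]
  field_simp
end

section
/- Let a, b, ε, t be real numbers with a > 0, b > 0 and a ≠ b. Then the improper integral (1/(2π)) ∫_{−∞}^{∞} (ω² + ε²)·e^{iωt} / ( (ω² + a²)·(ω² + b²) ) dω converges and equals (a² − ε²)/(2a·(a² − b²))·e^{−a|t|} + (b² − ε²)/(2b·(b² − a²))·e^{−b|t|}. -/
open Real MeasureTheory

lemma aux_laplace (a s : ℝ) (ha : 0 < a) :
    Integrable (fun x : ℝ => Complex.exp ((s * x : ℝ) * Complex.I) * Complex.exp ((-a * |x| : ℝ) : ℂ)) ∧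
    ∫ x : ℝ, Complex.exp ((s * x : ℝ) * Complex.I) * Complex.exp ((-a * |x| : ℝ) : ℂ)
      = ((2 * a / (s ^ 2 + a ^ 2) : ℝ) : ℂ) := by
  have h1 : Set.EqOn (fun x : ℝ => Complex.exp (((a : ℂ) + s * Complex.I) * x))
      (fun x : ℝ => Complex.exp ((s * x : ℝ) * Complex.I) * Complex.exp ((-a * |x| : ℝ) : ℂ)) (Set.Iic 0) := by
    intro x hx
    simp only
    rw [abs_of_nonpos hx, ← Complex.exp_add]
    congr 1
    push_cast
    ring
  have h2 : Set.EqOn (fun x : ℝ => Complex.exp ((-(a : ℂ) + s * Complex.I) * x))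
      (fun x : ℝ => Complex.exp ((s * x : ℝ) * Complex.I) * Complex.exp ((-a * |x| : ℝ) : ℂ)) (Set.Ioi 0) := by
    intro x hx
    simp only
    rw [abs_of_pos hx, ← Complex.exp_add]
    congr 1
    push_cast
    ring
  have r1 : 0 < ((a : ℂ) + s * Complex.I).re := by simpa using ha
  have r2 : (-(a : ℂ) + s * Complex.I).re < 0 := by simpa using ha
  have i1 := (integrableOn_exp_mul_complex_Iic r1 0).congr_fun h1 measurableSet_Iic
  have i2 := (integrableOn_exp_mul_complex_Ioi r2 0).congr_fun h2 measurableSet_Ioi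
  constructor
  · rw [← integrableOn_univ, ← Set.Iic_union_Ioi (a := (0 : ℝ))]
    exact i1.union i2
  · rw [← intervalIntegral.integral_Iic_add_Ioi i1 i2, ← setIntegral_congr_fun measurableSet_Iic h1,
      ← setIntegral_congr_fun measurableSet_Ioi h2, integral_exp_mul_complex_Iic r1,
      integral_exp_mul_complex_Ioi r2]
    have n1 : ((a : ℂ) + s * Complex.I) ≠ 0 := by
      intro h; rw [h] at r1; simp at r1
    have n2 : (-(a : ℂ) + s * Complex.I) ≠ 0 := by
      intro h; rw [h] at r2; simp at r2
    have n3 : ((s : ℂ) ^ 2 + a ^ 2) ≠ 0 := by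
      have : (s ^ 2 + a ^ 2 : ℝ) ≠ 0 := by positivity
      exact_mod_cast this
    push_cast
    simp only [mul_zero, Complex.exp_zero]
    rw [div_add_div _ _ n1 n2, div_eq_div_iff (mul_ne_zero n1 n2) n3]
    ring_nf
    simp only [Complex.I_sq]
    ring

lemma aux_int (a : ℝ) (ha : 0 < a) : Integrable (fun w : ℝ => 1 / (w ^ 2 + a ^ 2)) := by
  have h := (integrable_inv_one_add_sq.comp_mul_left' (inv_ne_zero ha.ne')).const_mul ((a ^ 2)⁻¹)
  refine h.congr (Filter.Eventually.of_forall fun x => ?_)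
  simp only
  have : x ^ 2 + a ^ 2 ≠ 0 := by positivity
  have : 1 + (a⁻¹ * x) ^ 2 ≠ 0 := by positivity
  field_simp
  ring

lemma aux_intc (a t : ℝ) (ha : 0 < a) : Integrable (fun w : ℝ =>
    Complex.exp (Complex.I * (w : ℂ) * (t : ℂ)) * ((1 / (w ^ 2 + a ^ 2) : ℝ) : ℂ)) := by
  refine (aux_int a ha).ofReal.bdd_mul (c := 1) (by fun_prop) ?_
  refine Filter.Eventually.of_forall fun w => ?_
  rw [Complex.norm_exp]
  simp

lemma aux_base (a t : ℝ) (ha : 0 < a) : ∫ w : ℝ,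
    Complex.exp (Complex.I * (w : ℂ) * (t : ℂ)) * ((1 / (w ^ 2 + a ^ 2) : ℝ) : ℂ)
      = ((π / a * Real.exp (-a * |t|) : ℝ) : ℂ) := by
  set f : ℝ → ℂ := fun x => Complex.exp ((-a * |x| : ℝ) : ℂ) with hf
  have hF : FourierTransform.fourier f
      = fun w : ℝ => ((2 * a * (1 / ((2 * π * w) ^ 2 + a ^ 2)) : ℝ) : ℂ) := by
    ext w
    rw [Real.fourier_real_eq_integral_exp_smul]
    have := (aux_laplace a (-2 * π * w) ha).2
    rw [show (2 * a * (1 / ((2 * π * w) ^ 2 + a ^ 2)) : ℝ) = 2 * a / ((-2 * π * w) ^ 2 + a ^ 2) by ring,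
      ← this]
    congr 1
    ext x
    rw [smul_eq_mul, show -2 * π * x * w = -2 * π * w * x by ring]
  have fi : Integrable f := by
    have := (aux_laplace a 0 ha).1
    simpa [hf] using this
  have Fi : Integrable (FourierTransform.fourier f) := by
    rw [hF]
    exact (((aux_int a ha).comp_mul_left' (R := 2 * π) (by positivity)).const_mul (2 * a)).ofReal
  have key := congrFun (Continuous.fourierInv_fourier_eq (f := f) (by fun_prop) fi Fi) t
  rw [Real.fourierInv_eq', hF] at key
  have e : ∀ v : ℝ, Complex.exp (((2 * π * inner ℝ v t : ℝ) : ℂ) * Complex.I) •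
      (((2 * a * (1 / ((2 * π * v) ^ 2 + a ^ 2)) : ℝ)) : ℂ)
      = (2 * a : ℂ) * (fun w : ℝ => Complex.exp (Complex.I * (w : ℂ) * (t : ℂ)) *
        ((1 / (w ^ 2 + a ^ 2) : ℝ) : ℂ)) (2 * π * v) := by
    intro v
    have : (inner ℝ v t : ℝ) = t * v := by simp
    rw [this, smul_eq_mul]
    simp only
    rw [show ((2 * π * (t * v) : ℝ) : ℂ) * Complex.I = Complex.I * ((2 * π * v : ℝ) : ℂ) * t by
      push_cast; ring]
    push_cast
    ring
  simp_rw [e] at key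
  rw [integral_const_mul, Measure.integral_comp_mul_left (fun w : ℝ =>
    Complex.exp (Complex.I * (w : ℂ) * (t : ℂ)) * ((1 / (w ^ 2 + a ^ 2) : ℝ) : ℂ)) (2 * π),
    abs_of_pos (by positivity)] at key
  simp only [hf, Complex.real_smul] at key
  have p0 : (π : ℂ) ≠ 0 := by exact_mod_cast Real.pi_ne_zero
  have a0 : (a : ℂ) ≠ 0 := by exact_mod_cast ha.ne'
  rw [Complex.ofReal_mul, Complex.ofReal_exp, ← key]
  generalize (∫ w : ℝ, Complex.exp (Complex.I * (w : ℂ) * (t : ℂ)) *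
    ((1 / (w ^ 2 + a ^ 2) : ℝ) : ℂ)) = J
  push_cast
  field_simp

/-- Inverse Fourier transform computation (via partial fraction expansion)
yielding the locked-state autocorrelation function of the PLL phase noise from its power
spectral density (equation (17) of the paper, after the substitution `ω = 2πf`). -/
theorem stmt12 (a b ε t : ℝ) (ha : 0 < a) (hb : 0 < b) (hab : a ≠ b) :
    Integrable (fun ω : ℝ =>
      (((ω ^ 2 + ε ^ 2 : ℝ) : ℂ) * Complex.exp (Complex.I * (ω : ℂ) * (t : ℂ))) /
        (((ω ^ 2 + a ^ 2) * (ω ^ 2 + b ^ 2) : ℝ) : ℂ)) ∧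
    ((1 / (2 * (π : ℂ))) * ∫ ω : ℝ,
        (((ω ^ 2 + ε ^ 2 : ℝ) : ℂ) * Complex.exp (Complex.I * (ω : ℂ) * (t : ℂ))) /
          (((ω ^ 2 + a ^ 2) * (ω ^ 2 + b ^ 2) : ℝ) : ℂ))
      = (((a ^ 2 - ε ^ 2) / (2 * a * (a ^ 2 - b ^ 2)) * Real.exp (-a * |t|)
          + (b ^ 2 - ε ^ 2) / (2 * b * (b ^ 2 - a ^ 2)) * Real.exp (-b * |t|) : ℝ) : ℂ) := by
  have h1 : a ^ 2 - b ^ 2 ≠ 0 := by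
    intro h
    have : (a - b) * (a + b) = 0 := by linarith
    rcases mul_eq_zero.1 this with h | h
    · exact hab (by linarith)
    · linarith
  have h2 : b ^ 2 - a ^ 2 ≠ 0 := fun h => h1 (by linarith)
  have e : (fun ω : ℝ =>
      (((ω ^ 2 + ε ^ 2 : ℝ) : ℂ) * Complex.exp (Complex.I * (ω : ℂ) * (t : ℂ))) /
        (((ω ^ 2 + a ^ 2) * (ω ^ 2 + b ^ 2) : ℝ) : ℂ)) = fun ω : ℝ =>
      (((a ^ 2 - ε ^ 2) / (a ^ 2 - b ^ 2) : ℝ) : ℂ) *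
        (Complex.exp (Complex.I * (ω : ℂ) * (t : ℂ)) * ((1 / (ω ^ 2 + a ^ 2) : ℝ) : ℂ)) +
      (((b ^ 2 - ε ^ 2) / (b ^ 2 - a ^ 2) : ℝ) : ℂ) *
        (Complex.exp (Complex.I * (ω : ℂ) * (t : ℂ)) * ((1 / (ω ^ 2 + b ^ 2) : ℝ) : ℂ)) := by
    ext ω
    have : (ω ^ 2 + ε ^ 2) / ((ω ^ 2 + a ^ 2) * (ω ^ 2 + b ^ 2)) =
        (a ^ 2 - ε ^ 2) / (a ^ 2 - b ^ 2) * (1 / (ω ^ 2 + a ^ 2)) +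
        (b ^ 2 - ε ^ 2) / (b ^ 2 - a ^ 2) * (1 / (ω ^ 2 + b ^ 2)) := by
      have n1 : ω ^ 2 + a ^ 2 ≠ 0 := by positivity
      have n2 : ω ^ 2 + b ^ 2 ≠ 0 := by positivity
      rw [show b ^ 2 - a ^ 2 = -(a ^ 2 - b ^ 2) by ring]
      field_simp
      ring
    rw [mul_comm, mul_div_assoc, ← Complex.ofReal_div, this]
    push_cast
    ring
  rw [e]
  have i1 := (aux_intc a t ha).const_mul (((a ^ 2 - ε ^ 2) / (a ^ 2 - b ^ 2) : ℝ) : ℂ)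
  have i2 := (aux_intc b t hb).const_mul (((b ^ 2 - ε ^ 2) / (b ^ 2 - a ^ 2) : ℝ) : ℂ)
  refine ⟨i1.add i2, ?_⟩
  rw [integral_add i1 i2, integral_const_mul, integral_const_mul, aux_base a t ha,
    aux_base b t hb]
  rw [show (1 / (2 * (π : ℂ))) = ((1 / (2 * π) : ℝ) : ℂ) by push_cast; rfl]
  norm_cast
  have := Real.pi_ne_zero
  field_simp
end

section
/- Let M be a finite nonempty index set, μ ∈ ℂ with μ ≠ 0, and for each m ∈ M let A_m ∈ ℝ with A_m > 0 and G^s_m ∈ ℂ with A_m·G^s_m = μ. Let s ∈ ℂ with s ≠ 0 and √2·s + μ ≠ 0, let ε, G^p, c ∈ ℂ, and let W_m, Φ_m, Θ ∈ ℂ satisfy: (i) s·Φ_m = ( −A_m·(Φ_m + Θ) + W_m )·G^s_m/√2 for every m ∈ M, and (ii) s·Θ = (1 + ε/s)·(G^p/√2)·Σ_{m∈M} ( −(A_m/G^s_m)·(Φ_m + Θ) + W_m/G^s_m ) + c/s. Then ( s + Σ_{m∈M} (s + ε)·A_m²·G^p / ( μ·(√2·s + μ) ) )·Θ = Σ_{m∈M}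 (s + ε)·A_m·G^p·W_m / ( μ·(√2·s + μ) ) + c/s. -/
open Finset

/-- Laplace-domain solution of the coupled linearized equations of the
weighted carrier-arraying architecture (equations (25)–(26) of the paper): each secondary
PLL at antenna `m` has loop gain `Gˢ m` adapted so that `A m · Gˢ m = μ`, the primary loop
has gain `Gᵖ`, loop filter `1 + ε/s` and constant frequency-offset contribution `c`. -/
theorem stmt14 {ι : Type*} (M : Finset ι) (hM : M.Nonempty)
    (μ : ℂ) (hμ : μ ≠ 0) (A : ι → ℝ) (hA : ∀ m ∈ M, 0 < A m)
    (Gs : ι → ℂ) (hGs : ∀ m ∈ M, (A m : ℂ) * Gs m = μ)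
    (s : ℂ) (hs : s ≠ 0) (hs2 : (Real.sqrt 2 : ℂ) * s + μ ≠ 0)
    (ε Gp c : ℂ) (W Φ : ι → ℂ) (Θ : ℂ)
    (hsec : ∀ m ∈ M,
      s * Φ m = (-(A m : ℂ) * (Φ m + Θ) + W m) * Gs m / (Real.sqrt 2 : ℂ))
    (hprim : s * Θ = (1 + ε / s) * (Gp / (Real.sqrt 2 : ℂ)) *
        (∑ m ∈ M, (-(A m : ℂ) / Gs m * (Φ m + Θ) + W m / Gs m)) + c / s) :
    (s + ∑ m ∈ M, (s + ε) * (A m : ℂ) ^ 2 * Gp / (μ * ((Real.sqrt 2 : ℂ) * s + μ))) * Θ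
      = (∑ m ∈ M, (s + ε) * (A m : ℂ) * Gp * W m / (μ * ((Real.sqrt 2 : ℂ) * s + μ)))
        + c / s := by
  have hr : (Real.sqrt 2 : ℂ) ≠ 0 := by
    exact_mod_cast (Real.sqrt_pos.mpr (by norm_num : (0:ℝ) < 2)).ne'
  generalize (Real.sqrt 2 : ℂ) = r at *
  have key : ∀ m ∈ M, (1 + ε / s) * (Gp / r) *
      (-(A m : ℂ) / Gs m * (Φ m + Θ) + W m / Gs m)
      = (s + ε) * (A m : ℂ) * Gp * W m / (μ * (r * s + μ))
        - (s + ε) * (A m : ℂ) ^ 2 * Gp / (μ * (r * s + μ)) * Θ := by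
    intro m hm
    have h1 := hGs m hm
    have h2 := hsec m hm
    have hG : Gs m ≠ 0 := by
      intro h
      rw [h, mul_zero] at h1
      exact hμ h1.symm
    rw [eq_div_iff hr] at h2
    have h3 : (r * s + μ) * (-(A m : ℂ) * (Φ m + Θ) + W m) = r * s * (W m - A m * Θ) := by
      linear_combination (-(A m : ℂ)) * h2 - (-(A m : ℂ) * (Φ m + Θ) + W m) * h1
    have h4 : -(A m : ℂ) / Gs m * (Φ m + Θ) + W m / Gs m
        = (A m : ℂ) * (r * s * (W m - A m * Θ)) / (μ * (r * s + μ)) := by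
      rw [eq_div_iff (mul_ne_zero hμ hs2), ← h3, ← h1]
      field_simp
    rw [h4]
    field_simp
  rw [mul_sum, sum_congr rfl key, sum_sub_distrib, ← sum_mul] at hprim
  linear_combination hprim
end
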